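/- For every α ∈ (0, π/2), one has 2/(π − 2α) + 2/α + 2/(α − π) − 2·cot(α) − tan(α) < 0. -/

import Mathlib

open Real

/-- A differentiable function vanishing at `0` with nonnegative derivative on `[0, ∞)` is
nonnegative there. -/
lemma nonneg_of_hasDerivAt_nonneg {f f' : ℝ → ℝ} (hf : ∀ x, HasDerivAt f (f' x) x)
    (hf0 : f 0 = 0) (hf' : ∀ x, 0 ≤ x → 0 ≤ f' x) {x : ℝ} (hx : 0 ≤ x) : 0 ≤ f x := by
  have hmono : MonotoneOn f (Set.Ici 0) := by
    refine monotoneOn_of_deriv_nonneg (convex_Ici 0)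
      (fun y _ => (hf y).continuousAt.continuousWithinAt)
      (fun y _ => (hf y).differentiableAt.differentiableWithinAt) fun y hy => ?_
    rw [(hf y).deriv]
    exact hf' y (interior_subset hy)
  simpa [hf0] using hmono Set.self_mem_Ici hx hx

lemma cos_le_taylor_four {x : ℝ} (hx : 0 ≤ x) : cos x ≤ 1 - x ^ 2 / 2 + x ^ 4 / 24 := by
  have h := nonneg_of_hasDerivAt_nonneg (f := fun x => 1 - x ^ 2 / 2 + x ^ 4 / 24 - cos x)
    (f' := fun x => sin x - (x - x ^ 3 / 6))
    (fun y => by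
      refine HasDerivAt.congr_deriv
        ((((hasDerivAt_const y (1 : ℝ)).sub ((hasDerivAt_pow 2 y).div_const 2)).add
          ((hasDerivAt_pow 4 y).div_const 24)).sub (hasDerivAt_cos y)) ?_
      push_cast; ring)
    (by simp) (fun y hy => sub_nonneg.2 (sin_ge_sub_cube hy)) hx
  exact sub_nonneg.1 h

lemma sin_le_taylor_five {x : ℝ} (hx : 0 ≤ x) : sin x ≤ x - x ^ 3 / 6 + x ^ 5 / 120 := by
  have h := nonneg_of_hasDerivAt_nonneg (f := fun x => x - x ^ 3 / 6 + x ^ 5 / 120 - sin x)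
    (f' := fun x => 1 - x ^ 2 / 2 + x ^ 4 / 24 - cos x)
    (fun y => by
      refine HasDerivAt.congr_deriv
        ((((hasDerivAt_id y).sub ((hasDerivAt_pow 3 y).div_const 6)).add
          ((hasDerivAt_pow 5 y).div_const 120)).sub (hasDerivAt_sin y)) ?_
      push_cast; ring)
    (by simp) (fun y hy => sub_nonneg.2 (cos_le_taylor_four hy)) hx
  exact sub_nonneg.1 h

lemma taylor_six_le_cos {x : ℝ} (hx : 0 ≤ x) :
    1 - x ^ 2 / 2 + x ^ 4 / 24 - x ^ 6 / 720 ≤ cos x := by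
  have h := nonneg_of_hasDerivAt_nonneg
    (f := fun x => cos x - (1 - x ^ 2 / 2 + x ^ 4 / 24 - x ^ 6 / 720))
    (f' := fun x => x - x ^ 3 / 6 + x ^ 5 / 120 - sin x)
    (fun y => by
      refine HasDerivAt.congr_deriv (((hasDerivAt_cos y).sub ((((hasDerivAt_const y (1 : ℝ)).sub
        ((hasDerivAt_pow 2 y).div_const 2)).add ((hasDerivAt_pow 4 y).div_const 24)).sub
        ((hasDerivAt_pow 6 y).div_const 720)))) ?_
      push_cast; ring)
    (by simp) (fun y hy => sub_nonneg.2 (sin_le_taylor_five hy)) hx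
  exact sub_nonneg.1 h

lemma mul_sin_lt_three_sub_cos_mul {y : ℝ} (hy : 0 < y) (hy' : y ≤ 1.53) :
    (2 * π ^ 2 + 6 * y ^ 2) * sin y < (3 - cos y) * (y * (π ^ 2 - y ^ 2)) := by
  have hπ : 9.8690 < π ^ 2 := by nlinarith [pi_gt_d6]
  have hz : y ^ 2 ≤ 2.341 := by nlinarith
  have hz0 : 0 < y ^ 2 := by positivity
  have hs := mul_le_mul_of_nonneg_left (sin_le_taylor_five hy.le)
    (show 0 ≤ 2 * π ^ 2 + 6 * y ^ 2 by positivity)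
  have hc := mul_le_mul_of_nonneg_right (sub_le_sub_left (cos_le_taylor_four hy.le) 3)
    (show 0 ≤ y * (π ^ 2 - y ^ 2) from mul_nonneg hy.le (by linarith))
  have hpoly : 0 < π ^ 2 * (5 / 6 - 7 * y ^ 2 / 120) - (8 - y ^ 2 / 2 + (y ^ 2) ^ 2 / 120) := by
    nlinarith [mul_pos (sub_pos.2 hπ) (show 0 < 5 / 6 - 7 * y ^ 2 / 120 by linarith)]
  have := mul_pos (mul_pos hy hz0) hpoly
  linarith

lemma mul_sin_lt_three_add_cos_mul {t : ℝ} (ht : 0 < t) (ht' : t ≤ 1.612) :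
    (8 * π ^ 2 - 12 * π * t + 6 * t ^ 2) * sin t <
      (3 + cos t) * (t * (π - t) * (2 * π - t)) := by
  have hπ := pi_gt_d6
  have hs := mul_le_mul_of_nonneg_left (sin_le_taylor_five ht.le)
    (show 0 ≤ 8 * π ^ 2 - 12 * π * t + 6 * t ^ 2 by nlinarith [sq_nonneg (π - t), sq_nonneg π])
  have hc := mul_le_mul_of_nonneg_right (add_le_add_right (taylor_six_le_cos ht.le) 3)
    (show 0 ≤ t * (π - t) * (2 * π - t) from
      mul_nonneg (mul_nonneg ht.le (by linarith)) (by linarith))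
  have hD : 0 < 1 / 6 + t ^ 2 / 120 - t ^ 4 / 720 := by
    nlinarith [show t ^ 2 ≤ 3 by nlinarith, sq_nonneg t]
  have hπt : 3.1415 * (6.283 - 3 * t) ≤ π * (2 * π - 3 * t) := by nlinarith
  have hB : 0 < 3.1415 * (6.283 - 3 * t) * (1 / 6 + t ^ 2 / 120 - t ^ 4 / 720) +
      (-2 + t ^ 2 / 2 - t ^ 4 / 120 - t ^ 6 / 720) := by
    obtain ⟨u, rfl⟩ : ∃ u, t = 1.612 - u := ⟨1.612 - t, by ring⟩
    have hu : 0 ≤ u := by linarith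
    have hu' : u ≤ 1.612 := by linarith
    have h6 : 0 ≤ u ^ 4 * (2.6 - u ^ 2) := mul_nonneg (by positivity) (by nlinarith)
    have hu4 : 0 ≤ u ^ 4 := by positivity
    linarith [pow_nonneg hu 2, pow_nonneg hu 3, pow_nonneg hu 5]
  have hpoly : 0 < π * (2 * π - 3 * t) * (1 / 6 + t ^ 2 / 120 - t ^ 4 / 720) +
      (-2 + t ^ 2 / 2 - t ^ 4 / 120 - t ^ 6 / 720) := by
    linarith [mul_le_mul_of_nonneg_right hπt hD.le]
  have := mul_pos (pow_pos ht 3) hpoly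
  linarith

/-- The logarithmic derivative of `f(α) = α²(π−α)² cos α / ((2α−π) sin² α)` is negative on
`(0, π/2)`. -/
theorem log_deriv_f_neg (α : ℝ) (hα : α ∈ Set.Ioo 0 (π / 2)) :
    2 / (π - 2 * α) + 2 / α + 2 / (α - π) - 2 * Real.cot α - Real.tan α < 0 := by
  obtain ⟨h0, h1⟩ := hα
  have key : (8 * π ^ 2 - 12 * π * (2 * α) + 6 * (2 * α) ^ 2) * sin (2 * α) <
      (3 + cos (2 * α)) * (2 * α * (π - 2 * α) * (2 * π - 2 * α)) := by
    rcases le_total (π - 2 * α) 1.53 with h | h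
    · have := mul_sin_lt_three_sub_cos_mul (y := π - 2 * α) (by linarith) h
      rw [sin_pi_sub, cos_pi_sub] at this
      linarith
    · exact mul_sin_lt_three_add_cos_mul (by linarith) (by linarith [pi_lt_d6])
  have hs : 0 < sin α := sin_pos_of_pos_of_lt_pi h0 (by linarith)
  have hc : 0 < cos α := cos_pos_of_mem_Ioo ⟨by linarith, h1⟩
  have hy : 0 < π - 2 * α := by linarith
  have hw : 0 < π - α := by linarith
  rw [sin_two_mul, cos_two_mul] at key
  have heq : 2 / (π - 2 * α) + 2 / α + 2 / (α - π) - 2 * Real.cot α - Real.tan α =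
      ((8 * π ^ 2 - 12 * π * (2 * α) + 6 * (2 * α) ^ 2) * (2 * sin α * cos α) -
        (3 + (2 * cos α ^ 2 - 1)) * (2 * α * (π - 2 * α) * (2 * π - 2 * α))) /
      (8 * α * (π - 2 * α) * (π - α) * sin α * cos α) := by
    have hw' : α - π = -(π - α) := by ring
    have hcs : 2 * cot α + tan α = (1 + cos α ^ 2) / (sin α * cos α) := by
      rw [cot_eq_cos_div_sin, tan_eq_sin_div_cos]
      field_simp
      linarith [sin_sq_add_cos_sq α]
    rw [sub_sub, hcs, hw', div_neg]
    field_simp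
    ring
  rw [heq]
  exact div_neg_of_neg_of_pos (sub_neg.2 key) (by positivity)
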